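/- Let η: ℝ → ℍ be a smooth curve with |η(s)| = 1, |η'(s)| = 1, and Re(conj(η'(s))·i·η(s)) = 0 for all s, and set u(s) := η'(s)·conj(η(s)). Then the projected curve γ := π ∘ η (where π(q) = q̃·q is the Hopf map) is differentiable with γ'(s) = 2·I(η(s))·u(s)·η(s) for all s ∈ ℝ, and in particular |γ'(s)| = 2 for all s; i.e., every horizontal unit-speed lift projects to a curve of constant speed 2. -/

import Mathlib

noncomputable section

/-- The quaternion i. -/
def qi : Quaternion ℝ := ⟨0, 1, 0, 0⟩

/-- The ℝ-linear involution of ℍ fixing 1, j, k and sending i to −i. -/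
def Iinv (q : Quaternion ℝ) : Quaternion ℝ := ⟨q.re, -q.imI, q.imJ, q.imK⟩

/-- The Hopf map π(q) = q̃ · q. -/
def hopfMap (q : Quaternion ℝ) : Quaternion ℝ := Iinv q * q

@[simp] theorem Iinv_re (q : Quaternion ℝ) : (Iinv q).re = q.re := rfl

@[simp] theorem Iinv_imI (q : Quaternion ℝ) : (Iinv q).imI = -q.imI := rfl

@[simp] theorem Iinv_imJ (q : Quaternion ℝ) : (Iinv q).imJ = q.imJ := rfl

@[simp] theorem Iinv_imK (q : Quaternion ℝ) : (Iinv q).imK = q.imK := rfl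

theorem Iinv_mul (p q : Quaternion ℝ) : Iinv (p * q) = Iinv q * Iinv p := by
  ext <;> simp <;> ring

theorem norm_Iinv (q : Quaternion ℝ) : ‖Iinv q‖ = ‖q‖ := by
  rw [← sq_eq_sq₀ (norm_nonneg _) (norm_nonneg _), sq, sq, ← Quaternion.normSq_eq_norm_mul_self,
    ← Quaternion.normSq_eq_norm_mul_self, Quaternion.normSq_def', Quaternion.normSq_def']
  simp

/-- The involution `Iinv` as a linear map. -/
def IinvLinear : Quaternion ℝ →ₗ[ℝ] Quaternion ℝ where
  toFun := Iinv
  map_add' p q := by ext <;> simp [add_comm]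
  map_smul' c q := by ext <;> simp

theorem HasDerivAt.Iinv {f : ℝ → Quaternion ℝ} {f' : Quaternion ℝ} {s : ℝ}
    (h : HasDerivAt f f' s) : HasDerivAt (fun t => _root_.Iinv (f t)) (_root_.Iinv f') s :=
  (LinearMap.toContinuousLinearMap IinvLinear).hasFDerivAt.comp_hasDerivAt s h

theorem Iinv_eq_self {q : Quaternion ℝ} (h : q.imI = 0) : Iinv q = q := by
  ext <;> simp [h]

/-- Horizontality of a velocity `p` at `q` says that `p * star q` has no `i`-component. -/
theorem imI_mul_star (p q : Quaternion ℝ) : (p * star q).imI = (star p * qi * q).re := by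
  have h₀ : qi.re = 0 := rfl
  have h₁ : qi.imI = 1 := rfl
  have h₂ : qi.imJ = 0 := rfl
  have h₃ : qi.imK = 0 := rfl
  simp [h₀, h₁, h₂, h₃]
  ring

/-- A horizontal unit-speed lift projects under the Hopf map to a curve
γ = π ∘ η with γ'(s) = 2·η̃(s)·u(s)·η(s), of constant speed 2. -/
theorem hopf_projection_speed_two
    (η η' : ℝ → Quaternion ℝ)
    (hsmooth : ContDiff ℝ (⊤ : ℕ∞) η)
    (hderiv : ∀ s, HasDerivAt η (η' s) s)
    (hnorm : ∀ s, ‖η s‖ = 1)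
    (hspeed : ∀ s, ‖η' s‖ = 1)
    (hperp : ∀ s, (star (η' s) * qi * η s).re = 0) :
    ∀ s : ℝ,
      HasDerivAt (fun t => hopfMap (η t))
        (2 * (Iinv (η s) * (η' s * star (η s)) * η s)) s ∧
      ‖(2 : Quaternion ℝ) * (Iinv (η s) * (η' s * star (η s)) * η s)‖ = 2 := by
  intro s
  have hstar : star (η s) * η s = 1 := by
    rw [Quaternion.star_mul_self, Quaternion.normSq_eq_norm_mul_self, hnorm]
    simp
  have hu : Iinv (η' s * star (η s)) = η' s * star (η s) :=
    Iinv_eq_self ((imI_mul_star _ _).trans (hperp s))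
  have hη' : η' s * star (η s) * η s = η' s := by rw [mul_assoc, hstar, mul_one]
  have hI : Iinv (η' s) = Iinv (η s) * (η' s * star (η s)) := by
    conv_lhs => rw [← hη', Iinv_mul, hu]
  constructor
  · have hγ' : 2 * (Iinv (η s) * (η' s * star (η s)) * η s) =
        Iinv (η' s) * η s + Iinv (η s) * η' s := by
      rw [hI, two_mul, mul_assoc (Iinv (η s)), hη']
    rw [hγ']
    exact (hderiv s).Iinv.mul (hderiv s)
  · rw [mul_assoc (Iinv (η s)), hη', norm_mul, norm_mul, norm_Iinv, hnorm, hspeed]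
    have h2 : ‖(2 : Quaternion ℝ)‖ = 2 := by
      exact (Quaternion.norm_coe (2 : ℝ)).trans (by norm_num)
    rw [h2]
    norm_num
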